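/- Soundness of SELAS over epistemic models: every ELAS formula derivable in the proof system SELAS is valid over epistemic models with assignments, i.e., if ⊢ φ in SELAS then for every epistemic model M, world w, and assignment σ, M,w,σ ⊨ φ. -/

import Mathlib

namespace ELAS

/-- Terms of ELAS: variables and names (each drawn from a denumerable set, here ℕ). -/
inductive Term : Type
  | var : ℕ → Term
  | name : ℕ → Term

/-- Formulas of ELAS. -/
inductive Formula : Type
  | eq : Term → Term → Formula
  | pred : ℕ → List Term → Formula
  | neg : Formula → Formula
  | and : Formula → Formula → Formula
  | know : Term → Formula → Formula
  | assign : ℕ → Term → Formula → Formula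

def Formula.imp (φ ψ : Formula) : Formula := .neg (.and φ (.neg ψ))
def Formula.iff (φ ψ : Formula) : Formula := .and (φ.imp ψ) (ψ.imp φ)
def Formula.top : Formula := (Formula.eq (.name 0) (.name 0)).imp (.eq (.name 0) (.name 0))
/-- ⟨x:=t⟩φ abbreviates ¬[x:=t]¬φ. -/
def Formula.dassign (x : ℕ) (t : Term) (φ : Formula) : Formula := .neg (.assign x t (.neg φ))

def Formula.conjList : List Formula → Formula
  | [] => Formula.top
  | φ :: l => .and φ (Formula.conjList l)

def Term.vars : Term → Finset ℕ
  | .var x => {x}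
  | .name _ => ∅

def Term.hasVar : Term → ℕ → Prop
  | .var x, z => x = z
  | .name _, _ => False

/-- Free variables, viewing [x:=t] as a quantifier binding x (the t is not bound). -/
def Formula.fv : Formula → Finset ℕ
  | .eq t t' => t.vars ∪ t'.vars
  | .pred _ ts => ts.foldr (fun t s => t.vars ∪ s) ∅
  | .neg φ => φ.fv
  | .and φ ψ => φ.fv ∪ ψ.fv
  | .know t φ => t.vars ∪ φ.fv
  | .assign x t φ => (φ.fv.erase x) ∪ t.vars

def Term.subst : Term → ℕ → ℕ → Term
  | .var z, x, y => if z = x then .var y else .var z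
  | .name a, _, _ => .name a

/-- φ.subst x y is φ[y/x]: substitute variable y for free occurrences of variable x. -/
def Formula.subst : Formula → ℕ → ℕ → Formula
  | .eq t t', x, y => .eq (t.subst x y) (t'.subst x y)
  | .pred P ts, x, y => .pred P (ts.map (fun t => t.subst x y))
  | .neg φ, x, y => .neg (φ.subst x y)
  | .and φ ψ, x, y => .and (φ.subst x y) (ψ.subst x y)
  | .know t φ, x, y => .know (t.subst x y) (φ.subst x y)
  | .assign z t φ, x, y =>
    if z = x then .assign z (t.subst x y) φ
    else .assign z (t.subst x y) (φ.subst x y)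

/-- φ[y/x] is admissible: every occurrence of y arising from a free occurrence of x is free. -/
def Formula.admissible : Formula → ℕ → ℕ → Prop
  | .eq _ _, _, _ => True
  | .pred _ _, _, _ => True
  | .neg φ, x, y => φ.admissible x y
  | .and φ ψ, x, y => φ.admissible x y ∧ ψ.admissible x y
  | .know _ φ, x, y => φ.admissible x y
  | .assign z _ φ, x, y => z = x ∨ ((x ∈ φ.fv → z ≠ y) ∧ φ.admissible x y)

/-- Variable z occurs (free or bound, anywhere) in φ. -/
def Formula.occurs : Formula → ℕ → Prop
  | .eq t t', z => t.hasVar z ∨ t'.hasVar z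
  | .pred _ ts, z => ∃ t ∈ ts, t.hasVar z
  | .neg φ, z => φ.occurs z
  | .and φ ψ, z => φ.occurs z ∨ ψ.occurs z
  | .know t φ, z => t.hasVar z ∨ φ.occurs z
  | .assign x t φ, z => x = z ∨ t.hasVar z ∨ φ.occurs z

/-- The assignment-free fragment EL. -/
def Formula.inEL : Formula → Prop
  | .eq _ _ => True
  | .pred _ _ => True
  | .neg φ => φ.inEL
  | .and φ ψ => φ.inEL ∧ ψ.inEL
  | .know _ φ => φ.inEL
  | .assign _ _ _ => False

/-- A constant-domain Kripke model for ELAS. -/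
structure Model : Type 1 where
  W : Type
  I : Type
  wNE : Nonempty W
  iNE : Nonempty I
  R : I → W → W → Prop
  ρ : ℕ → W → List I → Prop
  η : ℕ → W → I

/-- Epistemic model: every accessibility relation is an equivalence relation. -/
def Model.Epistemic (M : Model) : Prop := ∀ i : M.I, Equivalence (M.R i)

/-- Denotation σ_w(t) of a term. -/
def Model.den (M : Model) (w : M.W) (σ : ℕ → M.I) : Term → M.I
  | .var x => σ x
  | .name a => M.η a w

/-- Satisfaction M,w,σ ⊨ φ. -/
def Model.Sat (M : Model) : Formula → M.W → (ℕ → M.I) → Prop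
  | .eq t t', w, σ => M.den w σ t = M.den w σ t'
  | .pred P ts, w, σ => M.ρ P w (ts.map (M.den w σ))
  | .neg φ, w, σ => ¬ M.Sat φ w σ
  | .and φ ψ, w, σ => M.Sat φ w σ ∧ M.Sat ψ w σ
  | .know t φ, w, σ => ∀ v, M.R (M.den w σ t) w v → M.Sat φ v σ
  | .assign x t φ, w, σ => M.Sat φ w (Function.update σ x (M.den w σ t))

/-- φ is an instance of a propositional tautology (treating non-Boolean formulas as atoms). -/
def isTautology (φ : Formula) : Prop :=
  ∀ v : Formula → Prop,
    (∀ ψ, v (.neg ψ) ↔ ¬ v ψ) →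
    (∀ ψ χ, v (.and ψ χ) ↔ (v ψ ∧ v χ)) →
    v φ

/-- The proof system SELAS. -/
inductive Provable : Formula → Prop
  | taut {φ : Formula} : isTautology φ → Provable φ
  | distK (t : Term) (φ ψ : Formula) :
      Provable ((Formula.know t (φ.imp ψ)).imp ((Formula.know t φ).imp (.know t ψ)))
  | tx (x : ℕ) (φ : Formula) : Provable ((Formula.know (.var x) φ).imp φ)
  | four_x (x : ℕ) (φ : Formula) :
      Provable ((Formula.know (.var x) φ).imp (.know (.var x) (.know (.var x) φ)))
  | five_x (x : ℕ) (φ : Formula) :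
      Provable ((Formula.neg (.know (.var x) φ)).imp (.know (.var x) (.neg (.know (.var x) φ))))
  | id (t : Term) : Provable (.eq t t)
  | subP (P : ℕ) (ts ts' : List Term) (h : ts.length = ts'.length) :
      Provable ((Formula.conjList (List.zipWith Formula.eq ts ts')).imp
        ((Formula.pred P ts).iff (.pred P ts')))
  | subEq (t₁ t₂ t₁' t₂' : Term) :
      Provable ((Formula.and (.eq t₁ t₁') (.eq t₂ t₂')).imp
        ((Formula.eq t₁ t₂).iff (.eq t₁' t₂')))
  | subK (t t' : Term) (φ : Formula) :
      Provable ((Formula.eq t t').imp ((Formula.know t φ).iff (.know t' φ)))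
  | subAS (t t' : Term) (x : ℕ) (φ : Formula) :
      Provable ((Formula.eq t t').imp ((Formula.assign x t φ).iff (.assign x t' φ)))
  | rigidP (x y : ℕ) (t : Term) :
      Provable ((Formula.eq (.var x) (.var y)).imp (.know t (.eq (.var x) (.var y))))
  | rigidN (x y : ℕ) (t : Term) :
      Provable ((Formula.neg (.eq (.var x) (.var y))).imp
        (.know t (.neg (.eq (.var x) (.var y)))))
  | kAS (x : ℕ) (t : Term) (φ ψ : Formula) :
      Provable ((Formula.assign x t (φ.imp ψ)).imp ((Formula.assign x t φ).imp (.assign x t ψ)))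
  | detAS (x : ℕ) (t : Term) (φ : Formula) :
      Provable ((Formula.dassign x t φ).imp (.assign x t φ))
  | dAS (x : ℕ) (t : Term) : Provable (Formula.dassign x t Formula.top)
  | efAS (x : ℕ) (t : Term) : Provable (Formula.assign x t (.eq (.var x) t))
  | sub2AS (x y : ℕ) (φ : Formula) (h : φ.admissible x y) :
      Provable ((φ.subst x y).imp (.assign x (.var y) φ))
  | mp {φ ψ : Formula} : Provable (φ.imp ψ) → Provable φ → Provable ψ
  | necK (t : Term) {φ : Formula} : Provable φ → Provable (.know t φ)
  | necAS (x : ℕ) (t : Term) {φ ψ : Formula} (h : x ∉ φ.fv) :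
      Provable (φ.imp ψ) → Provable (φ.imp (.assign x t ψ))

end ELAS

open ELAS

theorem ELAS.den_congr (M : Model) (w : M.W) (σ τ : ℕ → M.I) (t : Term)
    (h : ∀ z ∈ t.vars, σ z = τ z) : M.den w σ t = M.den w τ t := by
  cases t with
  | var x => exact h x (by simp [Term.vars])
  | name a => rfl

theorem ELAS.mem_foldr_vars (ts : List Term) (t : Term) (ht : t ∈ ts) (z : ℕ) (hz : z ∈ t.vars) :
    z ∈ ts.foldr (fun t s => t.vars ∪ s) ∅ := by
  induction ts with
  | nil => simp at ht
  | cons a l ih =>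
    simp only [List.foldr_cons, Finset.mem_union]
    rcases List.mem_cons.1 ht with rfl | h
    · exact Or.inl hz
    · exact Or.inr (ih h)

/-- Coincidence: satisfaction depends only on the values of free variables. -/
theorem ELAS.sat_congr (M : Model) (φ : Formula) : ∀ (w : M.W) (σ τ : ℕ → M.I),
    (∀ z ∈ φ.fv, σ z = τ z) → (M.Sat φ w σ ↔ M.Sat φ w τ) := by
  induction φ with
  | eq t t' =>
    intro w σ τ h
    simp only [Formula.fv, Finset.mem_union] at h
    simp only [Model.Sat]
    rw [den_congr M w σ τ t (fun z hz => h z (Or.inl hz)),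
      den_congr M w σ τ t' (fun z hz => h z (Or.inr hz))]
  | pred P ts =>
    intro w σ τ h
    simp only [Model.Sat]
    rw [List.map_congr_left (fun t ht => den_congr M w σ τ t
      (fun z hz => h z (mem_foldr_vars ts t ht z hz)))]
  | neg φ ih =>
    intro w σ τ h
    simp only [Model.Sat]
    rw [ih w σ τ h]
  | and φ ψ ih1 ih2 =>
    intro w σ τ h
    simp only [Formula.fv, Finset.mem_union] at h
    simp only [Model.Sat]
    rw [ih1 w σ τ (fun z hz => h z (Or.inl hz)), ih2 w σ τ (fun z hz => h z (Or.inr hz))]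
  | know t φ ih =>
    intro w σ τ h
    simp only [Formula.fv, Finset.mem_union] at h
    simp only [Model.Sat]
    rw [den_congr M w σ τ t (fun z hz => h z (Or.inl hz))]
    exact forall_congr' fun v => imp_congr_right fun _ => ih v σ τ (fun z hz => h z (Or.inr hz))
  | assign x t φ ih =>
    intro w σ τ h
    simp only [Formula.fv, Finset.mem_union, Finset.mem_erase] at h
    simp only [Model.Sat]
    rw [den_congr M w σ τ t (fun z hz => h z (Or.inr hz))]
    apply ih
    intro z hz
    by_cases hx : z = x
    · subst hx; simp
    · simp [Function.update_of_ne hx, h z (Or.inl ⟨hx, hz⟩)]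

theorem ELAS.den_subst (M : Model) (w : M.W) (σ : ℕ → M.I) (t : Term) (x y : ℕ) :
    M.den w σ (t.subst x y) = M.den w (Function.update σ x (σ y)) t := by
  cases t with
  | var z =>
    by_cases h : z = x
    · subst h; simp [Term.subst, Model.den]
    · simp [Term.subst, Model.den, h]
  | name a => rfl

theorem ELAS.sat_subst (M : Model) (x y : ℕ) (φ : Formula) : φ.admissible x y →
    ∀ (w : M.W) (σ : ℕ → M.I),
    (M.Sat (φ.subst x y) w σ ↔ M.Sat φ w (Function.update σ x (σ y))) := by
  induction φ with
  | eq t t' =>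
    intro _ w σ
    simp only [Formula.subst, Model.Sat, den_subst]
  | pred P ts =>
    intro _ w σ
    simp only [Formula.subst, Model.Sat, List.map_map]
    have e : (M.den w σ ∘ fun t => t.subst x y) = M.den w (Function.update σ x (σ y)) :=
      funext fun t => den_subst M w σ t x y
    rw [e]
  | neg φ ih =>
    intro h w σ
    simp only [Formula.subst, Model.Sat, ih h]
  | and φ ψ ih1 ih2 =>
    intro h w σ
    simp only [Formula.subst, Model.Sat, ih1 h.1, ih2 h.2]
  | know t φ ih =>
    intro h w σ
    simp only [Formula.subst, Model.Sat, ih h, den_subst]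
  | assign z t φ ih =>
    intro h w σ
    by_cases hz : z = x
    · subst hz
      simp only [Formula.subst, if_true, Model.Sat, den_subst, Function.update_idem]
    · obtain h | ⟨h1, h2⟩ := h
      · exact absurd h hz
      · simp only [Formula.subst, if_neg hz, Model.Sat, den_subst, ih h2]
        apply sat_congr
        intro u hu
        by_cases hux : u = x
        · subst hux
          have h3 := h1 hu
          simp [Function.update_of_ne (Ne.symm h3), Function.update_of_ne (Ne.symm hz)]
        · by_cases huz : u = z
          · subst huz; simp [hux]
          · simp [hux, huz]

theorem ELAS.sat_imp (M : Model) (φ ψ : Formula) (w : M.W) (σ : ℕ → M.I) :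
    M.Sat (φ.imp ψ) w σ ↔ (M.Sat φ w σ → M.Sat ψ w σ) := by
  simp only [Formula.imp, Model.Sat]; tauto

theorem ELAS.sat_iff (M : Model) (φ ψ : Formula) (w : M.W) (σ : ℕ → M.I) :
    M.Sat (φ.iff ψ) w σ ↔ (M.Sat φ w σ ↔ M.Sat ψ w σ) := by
  simp only [Formula.iff, Model.Sat, sat_imp]; tauto

theorem ELAS.sat_conj (M : Model) (w : M.W) (σ : ℕ → M.I) : ∀ (ts ts' : List Term),
    ts.length = ts'.length → M.Sat (Formula.conjList (List.zipWith Formula.eq ts ts')) w σ →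
    ts.map (M.den w σ) = ts'.map (M.den w σ)
  | [], [], _, _ => rfl
  | [], _ :: _, h, _ => by simp at h
  | _ :: _, [], h, _ => by simp at h
  | a :: l, b :: l', h, hs => by
    simp only [List.zipWith_cons_cons, Formula.conjList, Model.Sat] at hs
    simp only [List.map_cons, hs.1]
    rw [sat_conj M w σ l l' (by simpa using h) hs.2]

/-- soundness of SELAS over epistemic models. -/
theorem stmt11 (φ : Formula) (h : Provable φ) :
    ∀ (M : Model), M.Epistemic → ∀ (w : M.W) (σ : ℕ → M.I), M.Sat φ w σ := by
  intro M hM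
  induction h with
  | taut h =>
    intro w σ
    exact h (fun ψ => M.Sat ψ w σ) (fun _ => Iff.rfl) (fun _ _ => Iff.rfl)
  | distK t φ ψ =>
    intro w σ
    simp only [sat_imp, Model.Sat]
    exact fun h1 h2 v hv => h1 v hv (h2 v hv)
  | tx x φ =>
    intro w σ
    simp only [sat_imp, Model.Sat]
    exact fun h => h w ((hM _).refl w)
  | four_x x φ =>
    intro w σ
    simp only [sat_imp, Model.Sat]
    exact fun h v hv u hu => h u ((hM _).trans hv hu)
  | five_x x φ =>
    intro w σ
    simp only [sat_imp, Model.Sat]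
    exact fun h v hv h' => h fun u hu => h' u ((hM _).trans ((hM _).symm hv) hu)
  | id t => intro w σ; rfl
  | subP P ts ts' hl =>
    intro w σ
    simp only [sat_imp, sat_iff]
    intro h
    simp only [Model.Sat, sat_conj M w σ ts ts' hl h]
  | subEq t₁ t₂ t₁' t₂' =>
    intro w σ
    simp only [sat_imp, sat_iff, Model.Sat]
    rintro ⟨h1, h2⟩
    rw [h1, h2]
  | subK t t' φ =>
    intro w σ
    simp only [sat_imp, sat_iff, Model.Sat]
    intro h; rw [h]
  | subAS t t' x φ =>
    intro w σ
    simp only [sat_imp, sat_iff, Model.Sat]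
    intro h; rw [h]
  | rigidP x y t =>
    intro w σ
    simp only [sat_imp, Model.Sat]
    exact fun h _ _ => h
  | rigidN x y t =>
    intro w σ
    simp only [sat_imp, Model.Sat]
    exact fun h _ _ => h
  | kAS x t φ ψ =>
    intro w σ
    simp only [sat_imp, Model.Sat]
    exact fun h => h
  | detAS x t φ =>
    intro w σ
    simp only [sat_imp, Formula.dassign, Model.Sat, not_not]
    exact fun h => h
  | dAS x t =>
    intro w σ
    simp only [Formula.dassign, Formula.top, sat_imp, Model.Sat, not_not]
    exact fun h => h
  | efAS x t =>
    intro w σ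
    cases t with
    | var y =>
      by_cases h : y = x
      · subst h; simp [Model.Sat, Model.den]
      · simp [Model.Sat, Model.den, h]
    | name a => simp [Model.Sat, Model.den]
  | sub2AS x y φ h =>
    intro w σ
    rw [sat_imp, sat_subst M x y φ h]
    exact fun h => h
  | mp _ _ ih1 ih2 =>
    intro w σ
    exact (sat_imp M _ _ w σ).1 (ih1 w σ) (ih2 w σ)
  | necK t _ ih =>
    intro w σ v _
    exact ih v σ
  | necAS x t hx _ ih =>
    intro w σ
    rw [sat_imp]
    intro h
    simp only [Model.Sat]
    refine (sat_imp M _ _ w _).1 (ih w (Function.update σ x (M.den w σ t))) ((sat_congr M _ w σ _ ?_).1 h)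
    intro z hz
    have : z ≠ x := fun e => hx (e ▸ hz)
    simp [this]
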